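/- arXiv:0907.3928 — 3 statements merged into one kernel-verified Lean document; each statement's English description precedes it below -/
import Mathlib

section
/- For every integer k ≥ 3, U_k^(1) \ U_{k−1}^(1) = ⋃_{j=0}^{⌊k/2⌋−1} {{v_{3k−4}, v_{(3k−5)−3j}}}, regardless of the parity of k. -/
/-- `U_k^(1) = ⋃_{i=0}^{⌊k/2⌋-1} ⋃_{j=i}^{⌊k/2⌋-1} {{v_{(3k-4)-3i}, v_{(3k-5)-3j}}}`,
as a set of unordered pairs of vertex indices. -/
def U1 (k : ℕ) : Set (Sym2 ℕ) :=
  {e | ∃ i j : ℕ, i ≤ j ∧ j < k/2 ∧ e = s(3*k-4-3*i, 3*k-5-3*j)}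

/-- `U_k^(2) = ⋃_{i=0}^{⌊(k-1)/2⌋-1} ⋃_{j=0}^{⌊(k-1)/2⌋-1-i} {{v_{3i}, v_{(3i+1)+3j}}}`,
as a set of unordered pairs of vertex indices. -/
def U2 (k : ℕ) : Set (Sym2 ℕ) :=
  {e | ∃ i j : ℕ, i < (k-1)/2 ∧ j < (k-1)/2 - i ∧ e = s(3*i, 3*i+1+3*j)}

/-- `F_k = U_k^(1) ∪ U_k^(2)`. -/
def Fset (k : ℕ) : Set (Sym2 ℕ) := U1 k ∪ U2 k

/-- For every integer `k ≥ 3`, regardless of the parity of `k`,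
`U_k^(1) \ U_{k-1}^(1) = ⋃_{j=0}^{⌊k/2⌋-1} {{v_{3k-4}, v_{(3k-5)-3j}}}`. -/
theorem U1_sdiff_U1 (k : ℕ) (hk : 3 ≤ k) :
    U1 k \ U1 (k-1) = {e | ∃ j < k/2, e = s(3*k-4, 3*k-5-3*j)} := by
  ext e
  simp only [U1, Set.mem_sdiff, Set.mem_ofPred_eq]
  constructor
  · rintro ⟨⟨i, j, hij, hj, rfl⟩, hnot⟩
    rcases Nat.eq_zero_or_pos i with rfl | hi
    · exact ⟨j, hj, rfl⟩
    · refine absurd ⟨i - 1, j - 1, by omega, by omega, ?_⟩ hnot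
      rw [Sym2.eq_iff]
      omega
  · rintro ⟨j, hj, rfl⟩
    refine ⟨⟨0, j, j.zero_le, hj, rfl⟩, ?_⟩
    rintro ⟨i', j', hij, hj', h⟩
    rw [Sym2.eq_iff] at h
    omega
end

section
/- For every integer k ≥ 3 and every j ∈ {0, 1, …, ⌊k/2⌋ − 1}, the edge set of the 5-cycle C_k^(j) intersects F_k exactly in the single edge {v_{3k−4}, v_{(3k−5)−3j}}, and the edge set of C_k^(j) is disjoint from F_{k−1}. -/
/-- The edge set of the 5-cycle `C_k^(j)` with consecutive vertices
`v_{3k-4}, v_{(3k-5)-3j}, v_{3⌊(k-1)/2⌋}, v_{3k-2}, v_{3k-3}`. -/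
def Cedges (k j : ℕ) : Set (Sym2 ℕ) :=
  {s(3*k-4, 3*k-5-3*j), s(3*k-5-3*j, 3*((k-1)/2)), s(3*((k-1)/2), 3*k-2),
   s(3*k-2, 3*k-3), s(3*k-3, 3*k-4)}

/-- For every integer `k ≥ 3` and every `j ∈ {0, …, ⌊k/2⌋-1}`, the edge set of the 5-cycle
`C_k^(j)` intersects `F_k` exactly in the single edge `{v_{3k-4}, v_{(3k-5)-3j}}`, and is
disjoint from `F_{k-1}`. -/
theorem Cedges_inter (k j : ℕ) (hk : 3 ≤ k) (hj : j < k/2) :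
    Cedges k j ∩ Fset k = {s(3*k-4, 3*k-5-3*j)} ∧ Cedges k j ∩ Fset (k-1) = ∅ := by
  refine ⟨Set.Subset.antisymm ?_ ?_, Set.eq_empty_of_forall_notMem ?_⟩
  · rintro e ⟨he, hF⟩
    simp only [Cedges, Set.mem_insert_iff, Set.mem_singleton_iff] at he ⊢
    rcases he with rfl | he
    · rfl
    · exfalso
      rcases hF with ⟨a, b, hab, hb, rfl⟩ | ⟨a, b, ha, hb, rfl⟩ <;>
        simp only [Sym2.eq_iff] at he <;> omega
  · rintro e rfl
    exact ⟨Or.inl rfl, Or.inl ⟨0, j, Nat.zero_le j, hj, rfl⟩⟩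
  · rintro e ⟨he, hF⟩
    simp only [Cedges, Set.mem_insert_iff, Set.mem_singleton_iff] at he
    rcases hF with ⟨a, b, hab, hb, rfl⟩ | ⟨a, b, ha, hb, rfl⟩ <;>
      simp only [Sym2.eq_iff] at he <;> omega
end

section
/- For every odd integer k ≥ 3 and every i ∈ {0, 1, …, ⌊(k−1)/2⌋ − 1}, the edge set of the 5-cycle D_k^(i) intersects F_k exactly in the single edge {v_{3i}, v_{3⌊(k−1)/2⌋−2}}, and the edge set of D_k^(i) is disjoint from F_{k−1}. -/
/-- The edge set of the 5-cycle `D_k^(i)` with consecutive vertices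
`v_{3i}, v_{3⌊(k-1)/2⌋-2}, v_{3k-4}, v_{3k-3}, v_{3k-2}`. -/
def Dedges (k i : ℕ) : Set (Sym2 ℕ) :=
  {s(3*i, 3*((k-1)/2)-2), s(3*((k-1)/2)-2, 3*k-4), s(3*k-4, 3*k-3),
   s(3*k-3, 3*k-2), s(3*k-2, 3*i)}

/-- For every odd integer `k ≥ 3` and every `i ∈ {0, …, ⌊(k-1)/2⌋-1}`, the edge set of the
5-cycle `D_k^(i)` intersects `F_k` exactly in the single edge `{v_{3i}, v_{3⌊(k-1)/2⌋-2}}`,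
and is disjoint from `F_{k-1}`. -/
theorem Dedges_inter (k i : ℕ) (hk : 3 ≤ k) (hko : Odd k) (hi : i < (k-1)/2) :
    Dedges k i ∩ Fset k = {s(3*i, 3*((k-1)/2)-2)} ∧ Dedges k i ∩ Fset (k-1) = ∅ := by
  obtain ⟨m, rfl⟩ := hko
  have hm : (2 * m + 1 - 1) / 2 = m := by omega
  have hm' : (2 * m + 1) / 2 = m := by omega
  have hm'' : (2 * m + 1 - 1 - 1) / 2 = m - 1 := by omega
  rw [hm] at hi
  constructor
  · ext e
    simp only [Dedges, Fset, U1, U2, hm, hm', Set.mem_inter_iff, Set.mem_union,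
      Set.mem_insert_iff, Set.mem_singleton_iff, Set.mem_ofPred_eq]
    constructor
    · rintro ⟨rfl | rfl | rfl | rfl | rfl, ⟨a, b, hab, hb, h⟩ | ⟨a, b, ha, hb, h⟩⟩ <;>
        simp only [Sym2.eq_iff] at h ⊢ <;> omega
    · rintro rfl
      refine ⟨Or.inl rfl, Or.inr ⟨i, m - 1 - i, hi, by omega, ?_⟩⟩
      rw [Sym2.eq_iff]
      omega
  · ext e
    simp only [Dedges, Fset, U1, U2, hm, hm'', Set.mem_inter_iff, Set.mem_union,
      Set.mem_insert_iff, Set.mem_singleton_iff, Set.mem_ofPred_eq, Set.mem_empty_iff_false,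
      iff_false]
    rintro ⟨rfl | rfl | rfl | rfl | rfl, ⟨a, b, hab, hb, h⟩ | ⟨a, b, ha, hb, h⟩⟩ <;>
      simp only [Sym2.eq_iff] at h <;> omega
end
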